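/- Let $v \ge 0$ and let $m_1, \dots, m_v$ be integers with $m_j \ge 2$ for all $j$. For every real $s$ with $0 < s < 1$, one has $\prod_{j=1}^{v}\prod_{k=0}^{m_j-1} \Gamma\!\left(\tfrac{s+k}{m_j}\right)^{\frac{2k+1-m_j}{m_j}} \cdot \prod_{j=1}^{v}\prod_{k=0}^{m_j-1} \Gamma\!\left(\tfrac{1-s+k}{m_j}\right)^{-\frac{2k+1-m_j}{m_j}} = \prod_{j=1}^{v}\prod_{k=0}^{m_j-1} \left(\sin \tfrac{\pi(s+k)}{m_j}\right)^{\frac{m_j-2k-1}{m_j}}$, where all powers are real powers of positive real numbers and $\Gamma$ is the real Gamma function. Equivalently, $Z_{\mathrm{ell}}(s)/Z_{\mathrm{ell}}(1-s) = \prod_{j=1}^{v}\prod_{k=0}^{m_j-1} \left(\sin \tfrac{\pi(s+k)}{m_j}\right)^{\frac{m_j-2k-1}{m_j}}$. -/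

import Mathlib

open Real Finset

theorem sum_range_two_mul_add_one_sub_div (n : ℕ) :
    ∑ k ∈ range n, (2 * (k : ℝ) + 1 - n) / n = 0 := by
  have key (l : ℕ) (c : ℝ) : ∑ k ∈ range l, (2 * (k : ℝ) + 1 - c) = l * (l - c) := by
    induction l with
    | zero => simp
    | succ l ih => rw [sum_range_succ, ih]; push_cast; ring
  rw [← sum_div, key, sub_self, mul_zero, zero_div]

theorem prod_Gamma_rpow_reflect (n : ℕ) (s : ℝ) :
    ∏ k ∈ range n, Real.Gamma ((1 - s + k) / n) ^ (-((2 * (k : ℝ) + 1 - n) / n)) =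
      ∏ k ∈ range n, Real.Gamma (1 - (s + k) / n) ^ ((2 * (k : ℝ) + 1 - n) / n) := by
  rw [← prod_range_reflect]
  refine prod_congr rfl fun k hk => ?_
  have hkn : k + 1 ≤ n := mem_range.mp hk
  have hn : (n : ℝ) ≠ 0 := by
    norm_cast
    omega
  rw [show n - 1 - k = n - (k + 1) by omega, Nat.cast_sub hkn]
  push_cast
  congr 2
  · field_simp
    ring
  · ring

/-- The identity for a single ramification index `n`. -/
theorem prod_Gamma_rpow_mul_eq_prod_sin_rpow (n : ℕ) {s : ℝ} (hs0 : 0 < s) (hs1 : s < 1) :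
    (∏ k ∈ range n, Real.Gamma ((s + k) / n) ^ ((2 * (k : ℝ) + 1 - n) / n)) *
      (∏ k ∈ range n, Real.Gamma ((1 - s + k) / n) ^ (-((2 * (k : ℝ) + 1 - n) / n))) =
    ∏ k ∈ range n, Real.sin (Real.pi * (s + k) / n) ^ (((n : ℝ) - 2 * k - 1) / n) := by
  have factor : ∀ k ∈ range n,
      Real.Gamma ((s + k) / n) ^ ((2 * (k : ℝ) + 1 - n) / n) *
        Real.Gamma (1 - (s + k) / n) ^ ((2 * (k : ℝ) + 1 - n) / n) =
      Real.pi ^ ((2 * (k : ℝ) + 1 - n) / n) *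
        Real.sin (Real.pi * (s + k) / n) ^ (((n : ℝ) - 2 * k - 1) / n) := by
    intro k hk
    have hkn : (k : ℝ) + 1 ≤ n := by exact_mod_cast mem_range.mp hk
    have hk0 : (0 : ℝ) ≤ k := k.cast_nonneg
    have hx0 : 0 < (s + k) / n := div_pos (by linarith) (by linarith)
    have hx1 : (s + k) / n < 1 := (div_lt_one (by linarith)).mpr (by linarith)
    have hsin : 0 < Real.sin (Real.pi * ((s + k) / n)) :=
      Real.sin_pos_of_pos_of_lt_pi (by positivity) (by nlinarith [Real.pi_pos])
    rw [← Real.mul_rpow (Real.Gamma_pos_of_pos hx0).le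
        (Real.Gamma_pos_of_pos (sub_pos.mpr hx1)).le,
      Real.Gamma_mul_Gamma_one_sub, Real.div_rpow Real.pi_pos.le hsin.le, div_eq_mul_inv,
      ← Real.rpow_neg hsin.le, mul_div_assoc]
    congr 2
    ring
  rw [prod_Gamma_rpow_reflect, ← prod_mul_distrib, prod_congr rfl factor, prod_mul_distrib,
    ← Real.rpow_sum_of_pos Real.pi_pos, sum_range_two_mul_add_one_sub_div, Real.rpow_zero,
    one_mul]

/-- For integers `m₁, …, m_v ≥ 2` and real `0 < s < 1`,
`Z_ell(s) / Z_ell(1-s) = ∏_j ∏_{k=0}^{m_j - 1} (sin (π(s+k)/m_j))^{(m_j-2k-1)/m_j}`,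
where `Z_ell(s) = ∏_j ∏_{k=0}^{m_j-1} Γ((s+k)/m_j)^{(2k+1-m_j)/m_j}` with real
powers of positive reals and `Γ` the real Gamma function. -/
theorem Zell_quotient_eq_sin_prod (v : ℕ) (m : Fin v → ℕ) (hm : ∀ j, 2 ≤ m j)
    (s : ℝ) (hs0 : 0 < s) (hs1 : s < 1) :
    (∏ j, ∏ k ∈ Finset.range (m j),
        Real.Gamma ((s + k) / m j) ^ ((2 * (k : ℝ) + 1 - m j) / m j)) *
      (∏ j, ∏ k ∈ Finset.range (m j),
        Real.Gamma ((1 - s + k) / m j) ^ (-((2 * (k : ℝ) + 1 - m j) / m j))) =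
    ∏ j, ∏ k ∈ Finset.range (m j),
        Real.sin (Real.pi * (s + k) / m j) ^ (((m j : ℝ) - 2 * k - 1) / m j) := by
  rw [← prod_mul_distrib]
  exact prod_congr rfl fun j _ => prod_Gamma_rpow_mul_eq_prod_sin_rpow (m j) hs0 hs1
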